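/- arXiv:2110.05640 — 4 statements merged into one kernel-verified Lean document; each statement's English description precedes it below -/
import Mathlib

section
/- Let F be a field, let s ∈ F with s ≠ 0, set t = s², and assume t² ≠ 1. Let x ∈ F satisfy t² = 2x. For every integer n, define v = T_{n+1}(x)/(t² − 1), v⁺ = −s·T_n(x)/(t + 1), and v⁻ = −s·T_{n−1}(x)/(t + 1), where T_k denotes the k-th Chebyshev polynomial of the first kind. Then v, v⁺, v⁻ satisfy the skein relation t⁻¹·v⁻ − t·v⁺ = (s − s⁻¹)·v. -/
/-- Lemma 3.1 together with Corollary 3.4: if t = s², t² ≠ 1 and t² = 2x, then the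
rescaled consecutive Chebyshev values v = T_{n+1}(x)/(t²−1), v⁺ = −s·T_n(x)/(t+1),
v⁻ = −s·T_{n−1}(x)/(t+1) satisfy the skein relation t⁻¹·v⁻ − t·v⁺ = (s − s⁻¹)·v. -/
theorem chebyshev_solves_skein (F : Type*) [Field F] (s : F) (hs : s ≠ 0)
    (t : F) (ht : t = s ^ 2) (ht2 : t ^ 2 ≠ 1) (x : F) (hx : t ^ 2 = 2 * x) (n : ℤ) :
    t⁻¹ * (-s * (Polynomial.Chebyshev.T F (n - 1)).eval x / (t + 1))
      - t * (-s * (Polynomial.Chebyshev.T F n).eval x / (t + 1))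
      = (s - s⁻¹) * ((Polynomial.Chebyshev.T F (n + 1)).eval x / (t ^ 2 - 1)) := by
  have hp : t + 1 ≠ 0 := fun h => ht2 (by linear_combination (t - 1) * h)
  have hm : t - 1 ≠ 0 := fun h => ht2 (by linear_combination (t + 1) * h)
  have hrec : (Polynomial.Chebyshev.T F (n + 1)).eval x
      = t ^ 2 * (Polynomial.Chebyshev.T F n).eval x
        - (Polynomial.Chebyshev.T F (n - 1)).eval x := by
    rw [Polynomial.Chebyshev.T_add_one, hx]
    simp
  have hfac : t ^ 2 - 1 = (t - 1) * (t + 1) := by ring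
  rw [hrec, hfac]
  generalize (Polynomial.Chebyshev.T F n).eval x = a
  generalize (Polynomial.Chebyshev.T F (n - 1)).eval x = b
  clear hx hrec hfac ht2
  subst ht
  field_simp
  ring
end

section
/- Let F = ℚ(x, y) be the field of rational functions in two variables x, y over ℚ, and let (a_n)_{n≥1} be the sequence in F defined by a₁ = x, a₂ = y, and a_{n+1} = (a_n² + 1)/a_{n−1} for n ≥ 2 (each a_n is nonzero, so the sequence is well defined). Then for every n ≥ 1 there exist a polynomial p ∈ ℤ[x, y] and natural numbers k, l such that a_n = p(x, y)/(x^k · y^l); that is, every a_n is a Laurent polynomial in x and y with integer coefficients. -/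
theorem MvPolynomial.sq_add_one_ne_zero_of_fractionRing {σ : Type*}
    (f : FractionRing (MvPolynomial σ ℚ)) : f ^ 2 + 1 ≠ 0 := by
  intro h
  have hint : IsIntegral (MvPolynomial σ ℚ) f :=
    ⟨Polynomial.X ^ 2 + 1, by monicity!, by simpa using h⟩
  obtain ⟨g, rfl⟩ := IsIntegrallyClosed.isIntegral_iff.mp hint
  have hg : g ^ 2 + 1 = 0 := by
    apply IsFractionRing.injective (MvPolynomial σ ℚ) (FractionRing (MvPolynomial σ ℚ))
    simpa using h
  have h0 : (MvPolynomial.eval 0 g) ^ 2 + 1 = 0 := by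
    simpa using congrArg (MvPolynomial.eval 0) hg
  nlinarith [sq_nonneg (MvPolynomial.eval 0 g)]

section Recurrence

variable {K : Type*} [Field K] {a : ℕ → K}

theorem ne_zero_of_exchange_relation (hK : ∀ z : K, z ^ 2 + 1 ≠ 0)
    (h1 : a 1 ≠ 0) (h2 : a 2 ≠ 0)
    (harec : ∀ n, 2 ≤ n → a (n + 1) = (a n ^ 2 + 1) / a (n - 1)) (n : ℕ) :
    a (n + 1) ≠ 0 ∧ a (n + 2) ≠ 0 := by
  induction n with
  | zero => exact ⟨h1, h2⟩
  | succ n ih =>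
    refine ⟨ih.2, ?_⟩
    rw [harec (n + 2) (by omega)]
    exact div_ne_zero (hK _) ih.1

/-- The quantity `(a₁² + a₂² + 1) / (a₁ a₂)` is conserved by the exchange relation. -/
theorem conserved_of_exchange_relation (hne : ∀ n, a (n + 1) ≠ 0)
    (harec : ∀ n, 2 ≤ n → a (n + 1) = (a n ^ 2 + 1) / a (n - 1)) (n : ℕ) :
    a (n + 1) ^ 2 + a (n + 2) ^ 2 + 1 =
      (a 1 ^ 2 + a 2 ^ 2 + 1) / (a 1 * a 2) * (a (n + 1) * a (n + 2)) := by
  induction n with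
  | zero => exact (div_mul_cancel₀ _ (mul_ne_zero (hne 0) (hne 1))).symm
  | succ n ih =>
    have h : a (n + 3) * a (n + 1) = a (n + 2) ^ 2 + 1 := by
      rw [harec (n + 2) (by omega)]
      exact div_mul_cancel₀ _ (hne n)
    apply mul_left_cancel₀ (hne n)
    change a (n + 1) * (a (n + 2) ^ 2 + a (n + 3) ^ 2 + 1) =
      a (n + 1) * (_ * (a (n + 2) * a (n + 3)))
    linear_combination a (n + 3) * ih + (a (n + 3) - a (n + 1)) * h

theorem linear_recurrence_of_exchange_relation (hne : ∀ n, a (n + 1) ≠ 0)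
    (harec : ∀ n, 2 ≤ n → a (n + 1) = (a n ^ 2 + 1) / a (n - 1)) (n : ℕ) :
    a (n + 3) = (a 1 ^ 2 + a 2 ^ 2 + 1) / (a 1 * a 2) * a (n + 2) - a (n + 1) := by
  have h : a (n + 3) * a (n + 1) = a (n + 2) ^ 2 + 1 := by
    rw [harec (n + 2) (by omega)]
    exact div_mul_cancel₀ _ (hne n)
  apply mul_left_cancel₀ (hne n)
  linear_combination h + conserved_of_exchange_relation hne harec n

theorem exists_laurent_of_exchange_relation [Algebra ℤ K] (hne : ∀ n, a (n + 1) ≠ 0)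
    (harec : ∀ n, 2 ≤ n → a (n + 1) = (a n ^ 2 + 1) / a (n - 1)) (n : ℕ) :
    ∃ (p q : MvPolynomial (Fin 2) ℤ) (k : ℕ),
      a (n + 1) = MvPolynomial.aeval ![a 1, a 2] p / (a 1 ^ k * a 2 ^ k) ∧
      a (n + 2) = MvPolynomial.aeval ![a 1, a 2] q / (a 1 ^ k * a 2 ^ k) := by
  have h1 : a 1 ≠ 0 := hne 0
  have h2 : a 2 ≠ 0 := hne 1
  induction n with
  | zero => exact ⟨MvPolynomial.X 0, MvPolynomial.X 1, 0, by simp, by simp⟩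
  | succ n ih =>
    obtain ⟨p, q, k, hp, hq⟩ := ih
    refine ⟨MvPolynomial.X 0 * MvPolynomial.X 1 * q,
      (MvPolynomial.X 0 ^ 2 + MvPolynomial.X 1 ^ 2 + 1) * q -
        MvPolynomial.X 0 * MvPolynomial.X 1 * p, k + 1, ?_, ?_⟩
    · change a (n + 2) = _
      rw [hq]
      simp only [map_mul, MvPolynomial.aeval_X, Matrix.cons_val_zero, Matrix.cons_val_one]
      field_simp
      ring
    · change a (n + 3) = _
      rw [linear_recurrence_of_exchange_relation hne harec, hp, hq]
      simp only [map_mul, map_sub, map_add, map_pow, map_one, MvPolynomial.aeval_X,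
        Matrix.cons_val_zero, Matrix.cons_val_one]
      field_simp
      ring

end Recurrence

/-- The Laurent phenomenon for the rank 2 cluster algebra 𝒜(2,2): every term of the
sequence a₁ = x, a₂ = y, a_{n+1} = (aₙ² + 1)/a_{n−1} in ℚ(x,y) is a Laurent polynomial
in x and y with integer coefficients. -/
theorem laurent_phenomenon_A22
    (x y : FractionRing (MvPolynomial (Fin 2) ℚ))
    (hx : x = algebraMap (MvPolynomial (Fin 2) ℚ)
      (FractionRing (MvPolynomial (Fin 2) ℚ)) (MvPolynomial.X 0))
    (hy : y = algebraMap (MvPolynomial (Fin 2) ℚ)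
      (FractionRing (MvPolynomial (Fin 2) ℚ)) (MvPolynomial.X 1))
    (a : ℕ → FractionRing (MvPolynomial (Fin 2) ℚ))
    (ha1 : a 1 = x) (ha2 : a 2 = y)
    (harec : ∀ n, 2 ≤ n → a (n + 1) = (a n ^ 2 + 1) / a (n - 1)) :
    ∀ n, 1 ≤ n → ∃ (p : MvPolynomial (Fin 2) ℤ) (k l : ℕ),
      a n = MvPolynomial.aeval ![x, y] p / (x ^ k * y ^ l) := by
  have hX (i : Fin 2) : algebraMap (MvPolynomial (Fin 2) ℚ)
      (FractionRing (MvPolynomial (Fin 2) ℚ)) (MvPolynomial.X i) ≠ 0 :=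
    IsFractionRing.to_map_ne_zero_of_mem_nonZeroDivisors
      (mem_nonZeroDivisors_of_ne_zero (MvPolynomial.X_ne_zero i))
  have hne (n : ℕ) : a (n + 1) ≠ 0 :=
    (ne_zero_of_exchange_relation MvPolynomial.sq_add_one_ne_zero_of_fractionRing
      (by rw [ha1, hx]; exact hX 0) (by rw [ha2, hy]; exact hX 1) harec n).1
  intro n hn
  obtain ⟨m, rfl⟩ := Nat.exists_eq_add_of_le' hn
  obtain ⟨p, _, k, hp, _⟩ := exists_laurent_of_exchange_relation hne harec m
  rw [ha1, ha2] at hp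
  exact ⟨p, k, k, hp⟩
end

section
/- Let F = ℚ(x₁, x₂) be the field of rational functions in two variables x₁, x₂ over ℚ, and set y = (x₁² + x₂² + 1)/(x₁·x₂). Then for every natural number n ≥ 1, the element T_n(y)·(x₁·x₂)^n, where T_n is the n-th Chebyshev polynomial of the first kind, is (the image in F of) a polynomial in x₁ and x₂ with nonnegative integer coefficients. -/
/-- The `ℤ`-algebra structure is arbitrary, so that the lemma applies to any instance of it. -/
theorem aeval_map_natCast {σ K : Type*} [CommRing K] [Algebra ℤ K] (f : σ → K)
    (p : MvPolynomial σ ℕ) :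
    MvPolynomial.aeval f (MvPolynomial.map (Nat.castRingHom ℤ) p) = MvPolynomial.aeval f p := by
  rw [MvPolynomial.aeval_def, MvPolynomial.aeval_def, MvPolynomial.eval₂_map]
  congr 1
  exact Subsingleton.elim _ _

open MvPolynomial in
/-- Coefficientwise, `Tₙ(y) (ab)ⁿ` is nonnegative and dominates `a² Tₙ₋₁(y) (ab)ⁿ⁻¹`, where
`y = (a² + b² + 1) / (ab)`. -/
theorem exists_nat_mvPolynomial_aeval_eq_chebyshev {K : Type*} [Field K] {a b : K}
    (ha : a ≠ 0) (hb : b ≠ 0) (n : ℕ) :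
    ∃ p d : MvPolynomial (Fin 2) ℕ,
      aeval ![a, b] p =
        (Polynomial.Chebyshev.T K (n : ℤ)).eval ((a ^ 2 + b ^ 2 + 1) / (a * b)) * (a * b) ^ n ∧
      aeval ![a, b] (d + X 0 ^ 2 * p) =
        (Polynomial.Chebyshev.T K ((n + 1 : ℕ) : ℤ)).eval ((a ^ 2 + b ^ 2 + 1) / (a * b))
          * (a * b) ^ (n + 1) := by
  induction n with
  | zero =>
    refine ⟨1, X 1 ^ 2 + 1, by simp, ?_⟩
    simp
    field_simp
    ring
  | succ n ih =>
    obtain ⟨p, d, hp, hd⟩ := ih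
    refine ⟨d + X 0 ^ 2 * p,
      (X 0 ^ 2 + X 1 ^ 2 + 2) * (d + X 0 ^ 2 * p) + X 1 ^ 2 * d, hd, ?_⟩
    have hT : Polynomial.Chebyshev.T K ((n + 1 + 1 : ℕ) : ℤ) =
        2 * Polynomial.X * Polynomial.Chebyshev.T K ((n + 1 : ℕ) : ℤ)
          - Polynomial.Chebyshev.T K (n : ℤ) := by
      have h := Polynomial.Chebyshev.T_add_two K (n : ℤ)
      push_cast
      rwa [add_assoc]
    set y := (a ^ 2 + b ^ 2 + 1) / (a * b) with hy
    have hs : y * (a * b) = a ^ 2 + b ^ 2 + 1 := by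
      rw [hy]
      field_simp
    rw [hT]
    simp only [Polynomial.eval_sub, Polynomial.eval_mul, Polynomial.eval_X, Polynomial.eval_ofNat]
    simp only [map_add, map_mul, map_pow, map_ofNat, aeval_X, Matrix.cons_val_zero,
      Matrix.cons_val_one] at hp hd ⊢
    linear_combination (2 * (a ^ 2 + b ^ 2 + 1)) * hd - a ^ 2 * b ^ 2 * hp
      - 2 * (Polynomial.Chebyshev.T K ((n + 1 : ℕ) : ℤ)).eval y * (a * b) ^ (n + 1) * hs


/-- Sherman–Zelevinsky positivity (used in Lemma 3.6 of the paper): for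
y = (x₁² + x₂² + 1)/(x₁x₂) in ℚ(x₁,x₂), the element Tₙ(y)·(x₁x₂)ⁿ is a polynomial
in x₁, x₂ with nonnegative integer coefficients, for every n ≥ 1. -/
theorem chebyshev_cluster_positivity
    (x₁ x₂ : FractionRing (MvPolynomial (Fin 2) ℚ))
    (hx₁ : x₁ = algebraMap (MvPolynomial (Fin 2) ℚ)
      (FractionRing (MvPolynomial (Fin 2) ℚ)) (MvPolynomial.X 0))
    (hx₂ : x₂ = algebraMap (MvPolynomial (Fin 2) ℚ)
      (FractionRing (MvPolynomial (Fin 2) ℚ)) (MvPolynomial.X 1))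
    (y : FractionRing (MvPolynomial (Fin 2) ℚ))
    (hy : y = (x₁ ^ 2 + x₂ ^ 2 + 1) / (x₁ * x₂)) (n : ℕ) (hn : 1 ≤ n) :
    ∃ p : MvPolynomial (Fin 2) ℤ, (∀ m, 0 ≤ MvPolynomial.coeff m p) ∧
      MvPolynomial.aeval ![x₁, x₂] p =
        (Polynomial.Chebyshev.T (FractionRing (MvPolynomial (Fin 2) ℚ)) (n : ℤ)).eval y
          * (x₁ * x₂) ^ n := by
  have hinj := IsFractionRing.injective (MvPolynomial (Fin 2) ℚ)
    (FractionRing (MvPolynomial (Fin 2) ℚ))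
  have h₁ : x₁ ≠ 0 := by
    rw [hx₁]
    exact (map_ne_zero_iff _ hinj).2 (MvPolynomial.X_ne_zero 0)
  have h₂ : x₂ ≠ 0 := by
    rw [hx₂]
    exact (map_ne_zero_iff _ hinj).2 (MvPolynomial.X_ne_zero 1)
  obtain ⟨p, -, hp, -⟩ := exists_nat_mvPolynomial_aeval_eq_chebyshev h₁ h₂ n
  refine ⟨MvPolynomial.map (Nat.castRingHom ℤ) p, fun m => ?_, ?_⟩
  · simp [MvPolynomial.coeff_map]
  · rw [hy, ← hp]
    exact aeval_map_natCast _ p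
end

section
/- Let F be a field, let s ∈ F with s ≠ 0 and s⁴ ≠ 1, set t = s², and let x₁, x₂ ∈ F be nonzero elements satisfying t²·x₁·x₂ = 2·(x₁² + x₂² + 1). Set y = (x₁² + x₂² + 1)/(x₁·x₂). Then for every integer n, the elements v = T_{n+1}(y)/(t² − 1), v⁺ = −s·T_n(y)/(t + 1), and v⁻ = −s·T_{n−1}(y)/(t + 1), where T_k denotes the k-th Chebyshev polynomial of the first kind, satisfy the skein relation t⁻¹·v⁻ − t·v⁺ = (s − s⁻¹)·v. -/
/-- Theorem 1.1 (via Lemmas 3.1, 3.5 and Corollary 3.4): under the substitution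
t² = 2(x₁² + x₂² + 1)/(x₁x₂), the consecutive Chebyshev values at
y = (x₁² + x₂² + 1)/(x₁x₂), rescaled as in Lemma 3.1, solve the skein relation. -/
theorem chebyshev_cluster_solves_skein (F : Type*) [Field F] (s : F) (hs : s ≠ 0)
    (hs4 : s ^ 4 ≠ 1) (t : F) (ht : t = s ^ 2) (x₁ x₂ : F)
    (hx₁ : x₁ ≠ 0) (hx₂ : x₂ ≠ 0)
    (hsub : t ^ 2 * (x₁ * x₂) = 2 * (x₁ ^ 2 + x₂ ^ 2 + 1))
    (y : F) (hy : y = (x₁ ^ 2 + x₂ ^ 2 + 1) / (x₁ * x₂)) (n : ℤ) :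
    t⁻¹ * (-s * (Polynomial.Chebyshev.T F (n - 1)).eval y / (t + 1))
      - t * (-s * (Polynomial.Chebyshev.T F n).eval y / (t + 1))
      = (s - s⁻¹) * ((Polynomial.Chebyshev.T F (n + 1)).eval y / (t ^ 2 - 1)) := by
  have hx : x₁ * x₂ ≠ 0 := mul_ne_zero hx₁ hx₂
  have hty : t ^ 2 = 2 * y := by
    rw [hy, ← mul_div_assoc, eq_div_iff hx, hsub]
  have hrec : (Polynomial.Chebyshev.T F (n + 1)).eval y
      = t ^ 2 * (Polynomial.Chebyshev.T F n).eval y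
        - (Polynomial.Chebyshev.T F (n - 1)).eval y := by
    rw [Polynomial.Chebyshev.T_add_one, hty]
    simp
  have hfac : (t - 1) * (t + 1) ≠ 0 := fun h => hs4 (by
    subst ht
    linear_combination h)
  have hsub_one : t - 1 ≠ 0 := left_ne_zero_of_mul hfac
  have hadd_one : t + 1 ≠ 0 := right_ne_zero_of_mul hfac
  have hsq : t ^ 2 - 1 = (t - 1) * (t + 1) := by ring
  rw [hrec, hsq]
  subst ht
  field_simp
  ring
end
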